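/- Chance-constraint reformulation sufficiency. Let u be a random vector in ℝᵐ (m ≥ 1) distributed according to a multivariate Gaussian distribution with mean 0 and symmetric positive definite covariance matrix Σ_u. Let γ ∈ (0,1), u_max > 0, and q > 0 be such that P(χ²ₘ ≤ q) ≥ 1 − γ, where χ²ₘ has the chi-squared distribution with m degrees of freedom. If λ_max(Σ_u) ≤ u_max² / q, then P(‖u‖₂ ≤ u_max) ≥ 1 − γ. -/

import Mathlib

open Matrix MeasureTheory

/-- The multivariate Gaussian measure on `ℝᵐ` with mean `μ` and (positive definite)
covariance matrix `S`: the measure with density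
`x ↦ ((2π)^m det S)^(-1/2) exp (-½ (x-μ)ᵀ S⁻¹ (x-μ))` with respect to Lebesgue measure. -/
noncomputable def multivariateGaussian {m : ℕ} (μ : Fin m → ℝ)
    (S : Matrix (Fin m) (Fin m) ℝ) : Measure (Fin m → ℝ) :=
  volume.withDensity fun x =>
    ENNReal.ofReal ((Real.sqrt ((2 * Real.pi) ^ m * S.det))⁻¹ *
      Real.exp (-(1 / 2) * ((x - μ) ⬝ᵥ S⁻¹.mulVec (x - μ))))

/-- Integration in polar coordinates of a function of the norm, for the lower integral. -/
lemma lintegral_fun_norm_addHaar {E : Type*} [NormedAddCommGroup E] [NormedSpace ℝ E]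
    [Nontrivial E] [FiniteDimensional ℝ E] [MeasurableSpace E] [BorelSpace E]
    (μ : Measure E) [μ.IsAddHaarMeasure] {f : ℝ → ENNReal} (hf : Measurable f) :
    ∫⁻ x, f ‖x‖ ∂μ = Module.finrank ℝ E * μ (Metric.ball 0 1) *
      ∫⁻ y in Set.Ioi (0 : ℝ), ENNReal.ofReal (y ^ (Module.finrank ℝ E - 1)) * f y := by
  have hpolar := μ.measurePreserving_homeomorphUnitSphereProd.lintegral_comp_emb
    (Homeomorph.measurableEmbedding _)
    (fun p : Metric.sphere (0 : E) 1 × Set.Ioi (0 : ℝ) => f p.2)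
  simp only [homeomorphUnitSphereProd_apply_snd_coe] at hpolar
  have hfs : Measurable fun x : Set.Ioi (0 : ℝ) => f x := hf.comp measurable_subtype_coe
  rw [← restrict_compl_singleton (μ := μ) 0,
    ← lintegral_subtype_comap (measurableSet_singleton _).compl, hpolar,
    lintegral_prod (fun p : Metric.sphere (0 : E) 1 × Set.Ioi (0 : ℝ) => f p.2)
      (hfs.comp measurable_snd).aemeasurable, restrict_compl_singleton]
  simp only [lintegral_const, Measure.toSphere_apply_univ]
  rw [mul_comm, Measure.volumeIoiPow, lintegral_withDensity_eq_lintegral_mul _ (by fun_prop) hfs]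
  congr 1
  exact lintegral_subtype_comap measurableSet_Ioi
    (fun y : ℝ => ENNReal.ofReal (y ^ (Module.finrank ℝ E - 1)) * f y)

/-- The substitution `t = r ^ 2` on the positive half-line, for the lower integral. -/
lemma lintegral_Ioi_comp_sq (g : ℝ → ENNReal) :
    ∫⁻ t in Set.Ioi (0 : ℝ), g t =
      ∫⁻ r in Set.Ioi (0 : ℝ), ENNReal.ofReal (2 * r) * g (r ^ 2) := by
  have himage : (fun r : ℝ => r ^ 2) '' Set.Ioi 0 = Set.Ioi 0 := by
    ext t
    constructor
    · rintro ⟨r, hr, rfl⟩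
      exact pow_pos (Set.mem_Ioi.1 hr) 2
    · intro ht
      exact ⟨√t, Real.sqrt_pos.2 ht, Real.sq_sqrt (Set.mem_Ioi.1 ht).le⟩
  have hmono : MonotoneOn (fun r : ℝ => r ^ 2) (Set.Ioi 0) := fun a ha b _ hab =>
    pow_le_pow_left₀ (Set.mem_Ioi.1 ha).le hab 2
  have h := lintegral_image_eq_lintegral_deriv_mul_of_monotoneOn measurableSet_Ioi
    (fun x _ => by simpa using (hasDerivAt_pow 2 x).hasDerivWithinAt) hmono g
  rwa [himage] at h

/-- The normalising constants of the radial Gaussian density and of the chi-squared density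
agree. -/
lemma radial_gaussian_const_eq {m : ℕ} (hm : 1 ≤ m) {r : ℝ} (hr : 0 < r) :
    (m * (√Real.pi ^ m / Real.Gamma (m / 2 + 1))) *
        (r ^ (m - 1) * ((√((2 * Real.pi) ^ m))⁻¹ * Real.exp (-(1 / 2) * r ^ 2))) =
      2 * r * ((1 / 2) ^ (m / 2 : ℝ) / Real.Gamma (m / 2) * (r ^ 2) ^ ((m / 2 : ℝ) - 1) *
        Real.exp (-(1 / 2 * r ^ 2))) := by
  have hm0 : (0 : ℝ) < m := by exact_mod_cast hm
  have hG : 0 < Real.Gamma (m / 2 : ℝ) := Real.Gamma_pos_of_pos (by positivity)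
  have hsqrt : √((2 * Real.pi) ^ m) = √2 ^ m * √Real.pi ^ m := by
    rw [← mul_pow, ← Real.sqrt_mul (by norm_num), Real.sqrt_eq_rpow, Real.sqrt_eq_rpow,
      ← Real.rpow_natCast_mul (by positivity), ← Real.rpow_mul_natCast (by positivity), mul_comm (m : ℝ)]
  have hhalf : (1 / 2 : ℝ) ^ (m / 2 : ℝ) = (√2 ^ m)⁻¹ := by
    rw [one_div, Real.inv_rpow (by norm_num), Real.sqrt_eq_rpow,
      ← Real.rpow_mul_natCast (by norm_num)]
    congr 2
    ring
  have hpow : r * (r ^ 2) ^ ((m / 2 : ℝ) - 1) = r ^ (m - 1) := by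
    have hexp : ((m - 1 : ℕ) : ℝ) = 1 + (2 : ℕ) * ((m / 2 : ℝ) - 1) := by
      push_cast [hm]
      ring
    rw [← Real.rpow_natCast r (m - 1), hexp, Real.rpow_add hr, Real.rpow_one,
      Real.rpow_mul hr.le, Real.rpow_natCast]
  rw [Real.Gamma_add_one (by positivity), hsqrt, hhalf, ← hpow, neg_mul]
  have : (0 : ℝ) < √2 ^ m := by positivity
  have : (0 : ℝ) < √Real.pi ^ m := pow_pos (Real.sqrt_pos.2 Real.pi_pos) m
  field_simp

/-- The squared norm of a standard Gaussian vector has the chi-squared distribution. -/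
lemma map_dotProduct_self_multivariateGaussian_one {m : ℕ} (hm : 1 ≤ m) :
    (multivariateGaussian 0 (1 : Matrix (Fin m) (Fin m) ℝ)).map (fun x => x ⬝ᵥ x) =
      ProbabilityTheory.gammaMeasure (m / 2 : ℝ) (1 / 2) := by
  have : Nonempty (Fin m) := Fin.pos_iff_nonempty.1 hm
  have hdot : Measurable fun x : Fin m → ℝ => x ⬝ᵥ x := by
    unfold dotProduct
    fun_prop
  ext s hs
  set f : ℝ → ENNReal := fun r => (((fun r : ℝ => r ^ 2) ⁻¹' s).indicator
    fun r => ENNReal.ofReal ((√((2 * Real.pi) ^ m))⁻¹ * Real.exp (-(1 / 2) * r ^ 2))) r with hf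
  have hs2 : MeasurableSet ((fun r : ℝ => r ^ 2) ⁻¹' s) := (by fun_prop : Measurable _) hs
  have hfm : Measurable f := Measurable.indicator (by fun_prop) hs2
  have hball : volume (Metric.ball (0 : EuclideanSpace ℝ (Fin m)) 1) =
      ENNReal.ofReal (√Real.pi ^ m / Real.Gamma (m / 2 + 1)) := by
    simp [EuclideanSpace.volume_ball]
  have hG : 0 < Real.Gamma (m / 2 + 1 : ℝ) := Real.Gamma_pos_of_pos (by positivity)
  calc (multivariateGaussian 0 (1 : Matrix (Fin m) (Fin m) ℝ)).map (fun x => x ⬝ᵥ x) s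
      = ∫⁻ x : Fin m → ℝ, f ‖WithLp.toLp 2 x‖ := by
        rw [Measure.map_apply hdot hs, multivariateGaussian, withDensity_apply _ (hdot hs),
          ← lintegral_indicator (hdot hs)]
        refine lintegral_congr fun x => ?_
        have hx : ‖WithLp.toLp 2 x‖ ^ 2 = x ⬝ᵥ x := by
          rw [EuclideanSpace.norm_sq_eq]
          simp [dotProduct, pow_two]
        by_cases h : x ⬝ᵥ x ∈ s <;> simp [hf, h, hx]
    _ = ∫⁻ x : EuclideanSpace ℝ (Fin m), f ‖x‖ :=
        (PiLp.volume_preserving_toLp (Fin m)).lintegral_comp (hfm.comp measurable_norm)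
    _ = ∫⁻ r in Set.Ioi (0 : ℝ), ENNReal.ofReal (2 * r) *
          s.indicator (ProbabilityTheory.gammaPDF (m / 2) (1 / 2)) (r ^ 2) := by
        rw [lintegral_fun_norm_addHaar _ hfm, finrank_euclideanSpace_fin, hball,
          ← lintegral_const_mul _ (by fun_prop)]
        refine setLIntegral_congr_fun measurableSet_Ioi fun r hr => ?_
        have hr : 0 < r := hr
        by_cases h : r ^ 2 ∈ s
        · simp only [hf, Set.indicator, Set.mem_preimage, h, if_true]
          rw [ProbabilityTheory.gammaPDF_of_nonneg (sq_nonneg r),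
            ← ENNReal.ofReal_mul (by positivity), ← ENNReal.ofReal_mul (by positivity),
            ← radial_gaussian_const_eq hm hr,
            ← ENNReal.ofReal_natCast m, ← ENNReal.ofReal_mul (by positivity),
            ← ENNReal.ofReal_mul (by positivity)]
        · simp [hf, Set.indicator, h]
    _ = ∫⁻ t in Set.Ioi (0 : ℝ), s.indicator (ProbabilityTheory.gammaPDF (m / 2) (1 / 2)) t :=
        (lintegral_Ioi_comp_sq _).symm
    _ = ProbabilityTheory.gammaMeasure (m / 2 : ℝ) (1 / 2) s := by
        rw [ProbabilityTheory.gammaMeasure, withDensity_apply _ hs, ← lintegral_indicator hs,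
          ← setLIntegral_congr (Ioi_ae_eq_Ici (a := (0 : ℝ))).symm]
        refine setLIntegral_eq_of_support_subset fun t ht => ?_
        by_contra hneg
        simp [ProbabilityTheory.gammaPDF_of_neg (not_le.1 hneg)] at ht

/-- Whitening: a matrix `B` with `Bᵀ B = S⁻¹` maps the centred Gaussian measure with covariance
`S` to the standard one. -/
lemma map_mulVec_multivariateGaussian_zero {m : ℕ} {S B : Matrix (Fin m) (Fin m) ℝ}
    (hS : 0 < S.det) (hB : Bᵀ * B = S⁻¹) :
    (multivariateGaussian 0 S).map (fun x => B *ᵥ x) = multivariateGaussian 0 1 := by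
  have hdet : B.det ^ 2 = S.det⁻¹ := by
    rw [pow_two]
    nth_rewrite 1 [← det_transpose]
    rw [← det_mul, hB, det_nonsing_inv, Ring.inverse_eq_inv']
  have hB0 : B.det ≠ 0 := by
    intro h
    rw [h] at hdet
    have := inv_pos.2 hS
    simp_all
  have habs : √S.det = |B.det|⁻¹ := by
    rw [← inv_inv S.det, ← hdet, Real.sqrt_inv, Real.sqrt_sq_eq_abs]
  have hmeas : Measurable fun x : Fin m → ℝ => B *ᵥ x :=
    (toLin' B).continuous_of_finiteDimensional.measurable
  have hdot : Measurable fun x : Fin m → ℝ => x ⬝ᵥ x := by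
    unfold dotProduct
    fun_prop
  have hquad (x : Fin m → ℝ) : x ⬝ᵥ S⁻¹ *ᵥ x = (B *ᵥ x) ⬝ᵥ (B *ᵥ x) := by
    rw [← hB, ← mulVec_mulVec, dotProduct_mulVec, vecMul_transpose]
  ext s hs
  set g : (Fin m → ℝ) → ENNReal := s.indicator fun z => ENNReal.ofReal
    ((√((2 * Real.pi) ^ m * S.det))⁻¹ * Real.exp (-(1 / 2) * (z ⬝ᵥ z))) with hg
  have hgm : Measurable g := Measurable.indicator (by fun_prop) hs
  calc (multivariateGaussian 0 S).map (fun x => B *ᵥ x) s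
      = ∫⁻ x, g (B *ᵥ x) := by
        rw [Measure.map_apply hmeas hs, multivariateGaussian, withDensity_apply _ (hmeas hs),
          ← lintegral_indicator (hmeas hs)]
        refine lintegral_congr fun x => ?_
        by_cases h : B *ᵥ x ∈ s <;> simp [hg, h, hquad]
    _ = ∫⁻ z, g z ∂(volume.map (toLin' B)) :=
        (lintegral_map hgm hmeas).symm
    _ = ∫⁻ z, ENNReal.ofReal |B.det⁻¹| * g z := by
        rw [Real.map_matrix_volume_pi_eq_smul_volume_pi hB0, lintegral_smul_measure,
          smul_eq_mul, lintegral_const_mul _ hgm]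
    _ = multivariateGaussian 0 1 s := by
        rw [multivariateGaussian, withDensity_apply _ hs, ← lintegral_indicator hs]
        refine lintegral_congr fun z => ?_
        by_cases h : z ∈ s
        · simp only [hg, Set.indicator, h, if_true]
          rw [← ENNReal.ofReal_mul (abs_nonneg _), Real.sqrt_mul (by positivity), habs, abs_inv]
          have : |B.det| ≠ 0 := abs_ne_zero.2 hB0
          congr 1
          simp
          field_simp
        · simp [hg, Set.indicator, h]

/-- A positive definite matrix with eigenvalues at most `c` has a whitening matrix that contracts
squared norms by a factor no smaller than `c⁻¹`. -/
lemma exists_whitening_matrix {m : ℕ} {S : Matrix (Fin m) (Fin m) ℝ} (hS : S.PosDef) {c : ℝ}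
    (hc : ∀ i, hS.isHermitian.eigenvalues i ≤ c) :
    ∃ B : Matrix (Fin m) (Fin m) ℝ, Bᵀ * B = S⁻¹ ∧
      ∀ x, x ⬝ᵥ x ≤ c * ((B *ᵥ x) ⬝ᵥ (B *ᵥ x)) := by
  set d := hS.isHermitian.eigenvalues
  have hdpos (i) : 0 < d i := hS.eigenvalues_pos i
  set U : Matrix (Fin m) (Fin m) ℝ := (hS.isHermitian.eigenvectorUnitary).1
  have hUU : Uᵀ * U = 1 := by
    simpa [star_eq_conjTranspose] using
      Unitary.coe_star_mul_self hS.isHermitian.eigenvectorUnitary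
  have hUU' : U * Uᵀ = 1 := mul_eq_one_comm.1 hUU
  have hspec : S = U * diagonal d * Uᵀ := by
    have h := hS.isHermitian.spectral_theorem
    rw [Unitary.conjStarAlgAut_apply] at h
    simpa [star_eq_conjTranspose, Function.comp_def] using h
  have hsq (i) : √(d i) * √(d i) = d i := Real.mul_self_sqrt (hdpos i).le
  have hinv : S⁻¹ = U * diagonal (fun i => (d i)⁻¹) * Uᵀ := by
    refine inv_eq_right_inv ?_
    calc S * (U * diagonal (fun i => (d i)⁻¹) * Uᵀ)
        = U * (diagonal d * (Uᵀ * U) * diagonal (fun i => (d i)⁻¹)) * Uᵀ := by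
          rw [hspec]
          simp only [Matrix.mul_assoc]
      _ = 1 := by
          rw [hUU, Matrix.mul_one, diagonal_mul_diagonal]
          simp [(hdpos _).ne', hUU']
  refine ⟨diagonal (fun i => (√(d i))⁻¹) * Uᵀ, ?_, fun x => ?_⟩
  · rw [hinv, transpose_mul, transpose_transpose, diagonal_transpose, Matrix.mul_assoc,
      ← Matrix.mul_assoc (diagonal _) (diagonal _), diagonal_mul_diagonal, Matrix.mul_assoc]
    simp [← mul_inv, hsq]
  · have hx : x ⬝ᵥ x = (Uᵀ *ᵥ x) ⬝ᵥ (Uᵀ *ᵥ x) := by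
      rw [dotProduct_mulVec, vecMul_transpose, mulVec_mulVec, hUU', one_mulVec]
    rw [hx, ← mulVec_mulVec]
    simp only [dotProduct, Finset.mul_sum]
    refine Finset.sum_le_sum fun i _ => ?_
    rw [mulVec_diagonal]
    set w := (Uᵀ *ᵥ x) i
    calc w * w = d i * ((d i)⁻¹ * (w * w)) := by
          rw [mul_inv_cancel_left₀ (hdpos i).ne']
      _ ≤ c * ((d i)⁻¹ * (w * w)) :=
          mul_le_mul_of_nonneg_right (hc i)
            (mul_nonneg (inv_nonneg.2 (hdpos i).le) (mul_self_nonneg w))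
      _ = c * ((√(d i))⁻¹ * w * ((√(d i))⁻¹ * w)) := by
          rw [mul_mul_mul_comm, ← mul_inv, hsq]

/-- Chance-constraint reformulation sufficiency. Let `u` be a zero-mean
Gaussian random vector in `ℝᵐ` (`m ≥ 1`) with positive definite covariance `Σᵤ` whose
largest eigenvalue is `lmax`. Let `γ ∈ (0,1)`, `u_max > 0`, and `q > 0` be such that
`P(χ²ₘ ≤ q) ≥ 1 − γ`. If `lmax ≤ u_max² / q`, then `P(‖u‖₂ ≤ u_max) ≥ 1 − γ`. -/
theorem chance_constraint_reformulation_sufficiency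
    {m : ℕ} (hm : 1 ≤ m)
    {Ω : Type*} [MeasurableSpace Ω] (P : Measure Ω) [IsProbabilityMeasure P]
    (u : Ω → (Fin m → ℝ)) (hu : Measurable u)
    (Su : Matrix (Fin m) (Fin m) ℝ) (hSu : Su.PosDef)
    (hlaw : P.map u = multivariateGaussian 0 Su)
    (lmax : ℝ) (hlmax : IsGreatest (Set.range hSu.isHermitian.eigenvalues) lmax)
    (γ umax q : ℝ) (hγ : γ ∈ Set.Ioo (0 : ℝ) 1) (humax : 0 < umax) (hq : 0 < q)
    (hchi : ENNReal.ofReal (1 - γ) ≤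
      ProbabilityTheory.gammaMeasure (m / 2 : ℝ) (1 / 2) (Set.Iic q))
    (hbound : lmax ≤ umax ^ 2 / q) :
    ENNReal.ofReal (1 - γ) ≤ P {ω | Real.sqrt (u ω ⬝ᵥ u ω) ≤ umax} := by
  obtain ⟨B, hB, hcontract⟩ := exists_whitening_matrix hSu (c := lmax)
    fun i => hlmax.2 ⟨i, rfl⟩
  have hlpos : 0 ≤ lmax := by
    obtain ⟨i, hi⟩ := hlmax.1
    exact hi ▸ (hSu.eigenvalues_pos i).le
  have hdot : Measurable fun x : Fin m → ℝ => x ⬝ᵥ x := by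
    unfold dotProduct
    fun_prop
  have hmul : Measurable fun x : Fin m → ℝ => B *ᵥ x :=
    (toLin' B).continuous_of_finiteDimensional.measurable
  rw [← map_dotProduct_self_multivariateGaussian_one hm,
    ← map_mulVec_multivariateGaussian_zero hSu.det_pos hB, ← hlaw,
    Measure.map_map hdot hmul, Measure.map_map (hdot.comp hmul) hu,
    Measure.map_apply ((hdot.comp hmul).comp hu) measurableSet_Iic] at hchi
  refine hchi.trans (measure_mono fun ω hω => Real.sqrt_le_iff.2 ⟨humax.le, ?_⟩)
  calc u ω ⬝ᵥ u ω ≤ lmax * ((B *ᵥ u ω) ⬝ᵥ (B *ᵥ u ω)) := hcontract _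
    _ ≤ lmax * q := mul_le_mul_of_nonneg_left hω hlpos
    _ ≤ umax ^ 2 := (le_div_iff₀ hq).1 hbound
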